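/- Let X = (X₁,...,Xₙ) be a vector of i.i.d. standard Gaussian random variables and let f: ℝⁿ → ℝ be L-Lipschitz with respect to the Euclidean norm. Then f(X) − E[f(X)] is sub-Gaussian with parameter at most L; in particular, P(|f(X) − E[f(X)]| ≥ t) ≤ 2·exp(−t²/(2L²)) for all t ≥ 0. -/

import Mathlib

open MeasureTheory ProbabilityTheory Real

section LipschitzGaussian

open scoped NNReal Convolution

variable {E : Type*} [NormedAddCommGroup E] [InnerProductSpace ℝ E] [FiniteDimensional ℝ E]
  [MeasurableSpace E] [BorelSpace E] {L K : ℝ≥0} {f : E → ℝ}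

lemma integrable_exp_mul_norm_stdGaussian (c : ℝ) :
    Integrable (fun z : E ↦ exp (c * ‖z‖)) (stdGaussian E) := by
  obtain ⟨C, hC, hint⟩ := IsGaussian.exists_integrable_exp_sq (stdGaussian E)
  refine (hint.const_mul (exp (c ^ 2 / (4 * C)))).mono' (by fun_prop) (.of_forall fun z ↦ ?_)
  rw [norm_of_nonneg (exp_pos _).le, ← exp_add]
  gcongr
  have h : c ^ 2 / (4 * C) + C * ‖z‖ ^ 2 - c * ‖z‖ = (c - 2 * C * ‖z‖) ^ 2 / (4 * C) := by
    field_simp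
    ring
  have : 0 ≤ (c - 2 * C * ‖z‖) ^ 2 / (4 * C) := by positivity
  linarith

omit [InnerProductSpace ℝ E] [FiniteDimensional ℝ E] [MeasurableSpace E] [BorelSpace E] in
lemma LipschitzWith.abs_sub_le_mul_norm (hf : LipschitzWith L f) (x v : E) :
    |f (x + v) - f x| ≤ L * ‖v‖ := by
  simpa [dist_eq_norm] using hf.dist_le_mul (x + v) x

lemma LipschitzWith.integrable_exp_comp_stdGaussian (hf : LipschitzWith L f) :
    Integrable (fun z ↦ exp (f z)) (stdGaussian E) := by
  have hc := hf.continuous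
  refine ((integrable_exp_mul_norm_stdGaussian (E := E) L).const_mul (exp (f 0))).mono'
    (by fun_prop) (.of_forall fun z ↦ ?_)
  rw [norm_of_nonneg (exp_pos _).le, ← exp_add]
  gcongr
  have := (abs_le.1 (hf.abs_sub_le_mul_norm 0 z)).2
  rw [zero_add] at this
  linarith

lemma LipschitzWith.integrable_stdGaussian {F : Type*} [NormedAddCommGroup F]
    {f : E → F} (hf : LipschitzWith L f) :
    Integrable f (stdGaussian E) := by
  refine ((integrable_const ‖f 0‖).add
    ((IsGaussian.integrable_id (μ := stdGaussian E)).norm.const_mul (L : ℝ))).mono'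
    hf.continuous.aestronglyMeasurable (.of_forall fun z ↦ ?_)
  have h := hf.dist_le_mul z 0
  rw [dist_zero_right, dist_eq_norm] at h
  have := norm_sub_norm_le (f z) (f 0)
  simp only [Pi.add_apply, id]
  linarith

omit [FiniteDimensional ℝ E] [MeasurableSpace E] [BorelSpace E] in
lemma LipschitzWith.comp_add_smul {F : Type*} [PseudoMetricSpace F] {f : E → F}
    (hf : LipschitzWith L f) (x : E) (t : ℝ) :
    LipschitzWith (L * ‖t‖₊) (fun z ↦ f (x + t • z)) :=
  hf.comp (LipschitzWith.of_dist_le_mul fun y z ↦ by simp [dist_eq_norm, ← smul_sub, norm_smul])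

/-- The average of `f` over a standard Gaussian perturbation of scale `t`, that is, the heat
semigroup at time `t ^ 2 / 2`. -/
noncomputable def gaussianAverage (t : ℝ) (f : E → ℝ) (x : E) : ℝ :=
  ∫ z, f (x + t • z) ∂stdGaussian E

lemma LipschitzWith.gaussianAverage (hf : LipschitzWith L f) (t : ℝ) :
    LipschitzWith L (gaussianAverage t f) := by
  refine LipschitzWith.of_dist_le_mul fun x y ↦ ?_
  rw [_root_.gaussianAverage, _root_.gaussianAverage, dist_eq_norm, ← integral_sub
    (hf.comp_add_smul x t).integrable_stdGaussian (hf.comp_add_smul y t).integrable_stdGaussian]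
  refine (norm_integral_le_of_norm_le_const (C := L * dist x y) (.of_forall fun z ↦ ?_)).trans
    (by simp)
  simpa [dist_eq_norm] using hf.dist_le_mul (x + t • z) (y + t • z)

/-- Lipschitz functions whose derivative is Lipschitz. -/
structure LipschitzWithFDeriv (L K : ℝ≥0) (f : E → ℝ) : Prop where
  lipschitz : LipschitzWith L f
  differentiable : Differentiable ℝ f
  lipschitz_fderiv : LipschitzWith K (fderiv ℝ f)

lemma LipschitzWithFDeriv.gaussianAverage (hf : LipschitzWithFDeriv L K f) (t : ℝ) :
    LipschitzWithFDeriv L K (gaussianAverage t f) := by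
  have hint (x : E) : Integrable (fun z ↦ fderiv ℝ f (x + t • z)) (stdGaussian E) :=
    (hf.lipschitz_fderiv.comp_add_smul x t).integrable_stdGaussian
  have key (x : E) : HasFDerivAt (_root_.gaussianAverage t f)
      (∫ z, fderiv ℝ f (x + t • z) ∂stdGaussian E) x := by
    refine hasFDerivAt_integral_of_dominated_of_fderiv_le (bound := fun _ ↦ (L : ℝ))
      (F' := fun x z ↦ fderiv ℝ f (x + t • z)) Filter.univ_mem
      (.of_forall fun y ↦ (hf.lipschitz.comp_add_smul y t).integrable_stdGaussian.1)
      (hf.lipschitz.comp_add_smul x t).integrable_stdGaussian (hint x).1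
      (.of_forall fun z y _ ↦ norm_fderiv_le_of_lipschitz ℝ hf.lipschitz)
      (integrable_const _) (.of_forall fun z y _ ↦ ?_)
    exact (hasFDerivAt_comp_add_right (t • z)).2 (hf.differentiable (y + t • z)).hasFDerivAt
  refine ⟨hf.lipschitz.gaussianAverage t, fun x ↦ (key x).differentiableAt,
    LipschitzWith.of_dist_le_mul fun x y ↦ ?_⟩
  rw [(key x).fderiv, (key y).fderiv, dist_eq_norm, ← integral_sub (hint x) (hint y)]
  refine (norm_integral_le_of_norm_le_const (C := K * dist x y) (.of_forall fun z ↦ ?_)).trans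
    (by simp)
  simpa [dist_eq_norm] using hf.lipschitz_fderiv.dist_le_mul (x + t • z) (y + t • z)

lemma map_add_smul_stdGaussian_prod (t : ℝ) :
    ((stdGaussian E).prod (stdGaussian E)).map (fun p ↦ t • p.1 + t • p.2)
      = (stdGaussian E).map ((√2 * t) • ·) := by
  have h := IsGaussian.map_rotation_eq_self (μ := stdGaussian E) (by simp) (π / 4)
  have h2 : (fun p : E × E ↦ t • p.1 + t • p.2)
      = ((√2 * t) • ·) ∘ Prod.fst ∘ ContinuousLinearMap.rotation (π / 4) := by
    ext p
    have : √2 * t * (√2 / 2) = t := by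
      linear_combination t / 2 * mul_self_sqrt (show (0 : ℝ) ≤ 2 by norm_num)
    simp [ContinuousLinearMap.rotation_apply, smul_smul, this]
  rw [h2, ← Measure.map_map (by fun_prop) (by fun_prop), ← Measure.map_map (by fun_prop)
    (by fun_prop), h, Measure.map_fst_prod]
  simp

lemma gaussianAverage_gaussianAverage (hf : Continuous f) {t : ℝ} {x : E}
    (hint : Integrable (fun z ↦ f (x + (√2 * t) • z)) (stdGaussian E)) :
    gaussianAverage t (gaussianAverage t f) x = gaussianAverage (√2 * t) f x := by
  have hmap := map_add_smul_stdGaussian_prod (E := E) t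
  have h1 : Integrable (fun v ↦ f (x + v)) ((stdGaussian E).map ((√2 * t) • ·)) :=
    (integrable_map_measure (by fun_prop) (by fun_prop)).2 hint
  rw [← hmap, integrable_map_measure (by fun_prop) (by fun_prop)] at h1
  calc gaussianAverage t (gaussianAverage t f) x
      = ∫ p : E × E, f (x + (t • p.1 + t • p.2)) ∂(stdGaussian E).prod (stdGaussian E) := by
        simpa [gaussianAverage, add_assoc] using (integral_prod _ h1).symm
    _ = ∫ v, f (x + v) ∂(stdGaussian E).map ((√2 * t) • ·) := by
        rw [← hmap, integral_map (by fun_prop) (by fun_prop)]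
    _ = gaussianAverage (√2 * t) f x := integral_map (by fun_prop) (by fun_prop)

lemma gaussianAverage_exp_le_of_le {t c : ℝ}
    (h : ∀ f : E → ℝ, LipschitzWithFDeriv L K f → ∀ x,
      gaussianAverage t (fun y ↦ exp (f y)) x ≤ exp (gaussianAverage t f x + c))
    (hf : LipschitzWithFDeriv L K f) (x : E) :
    gaussianAverage (√2 * t) (fun y ↦ exp (f y)) x
      ≤ exp (gaussianAverage (√2 * t) f x + 2 * c) := by
  have hc := hf.lipschitz.continuous
  have hg := hf.gaussianAverage t
  have hexp (y : E) := (hf.lipschitz.comp_add_smul y (√2 * t)).integrable_exp_comp_stdGaussian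
  have hge := (hg.lipschitz.comp_add_smul x t).integrable_exp_comp_stdGaussian
  rw [← gaussianAverage_gaussianAverage (by fun_prop) (hexp x),
    ← gaussianAverage_gaussianAverage hc
      (hf.lipschitz.comp_add_smul x (√2 * t)).integrable_stdGaussian]
  calc gaussianAverage t (gaussianAverage t fun y ↦ exp (f y)) x
      ≤ ∫ z, exp (gaussianAverage t f (x + t • z)) * exp c ∂stdGaussian E := by
        refine integral_mono_of_nonneg (.of_forall fun z ↦ ?_) (hge.mul_const _)
          (.of_forall fun z ↦ ?_)
        · exact integral_nonneg fun z ↦ (exp_pos _).le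
        · simpa [exp_add] using h f hf (x + t • z)
    _ = gaussianAverage t (fun y ↦ exp (gaussianAverage t f y)) x * exp c :=
        integral_mul_const _ _
    _ ≤ exp (gaussianAverage t (gaussianAverage t f) x + c) * exp c := by
        gcongr
        exact h _ hg x
    _ = _ := by rw [← exp_add]; ring_nf

lemma exp_le_one_add_add_sq_add_abs_pow_mul_exp (u : ℝ) :
    exp u ≤ 1 + u + u ^ 2 / 2 + |u| ^ 3 * exp |u| := by
  have h := Complex.norm_exp_sub_sum_le_norm_mul_exp u 3
  simp only [Finset.sum_range_succ, Finset.sum_range_zero, Nat.factorial] at h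
  norm_cast at h
  have := (abs_le.1 h).2
  norm_num at this
  linarith

lemma pow_le_factorial_mul_exp {r : ℝ} (hr : 0 ≤ r) (n : ℕ) : r ^ n ≤ n.factorial * exp r := by
  have := pow_div_factorial_le_exp r hr n
  rwa [div_le_iff₀' (by positivity)] at this

omit [FiniteDimensional ℝ E] [MeasurableSpace E] [BorelSpace E] in
lemma LipschitzWithFDeriv.sq_sub_le (hf : LipschitzWithFDeriv L K f) (x v : E) :
    (f (x + v) - f x) ^ 2
      ≤ fderiv ℝ f x v ^ 2 + 2 * L * K * ‖v‖ ^ 3 + K ^ 2 * ‖v‖ ^ 4 := by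
  have hrem : |f (x + v) - f x - fderiv ℝ f x v| ≤ K * ‖v‖ ^ 2 := by
    have h := Convex.norm_image_sub_le_of_norm_fderiv_le' (𝕜 := ℝ) (f := f) (φ := fderiv ℝ f x)
      (s := Metric.closedBall x ‖v‖) (C := K * ‖v‖) (x := x) (y := x + v)
      (fun y _ ↦ hf.differentiable y) (fun y hy ↦ ?_) (convex_closedBall x _)
      (by simp) (by simp)
    · simpa [pow_two, mul_assoc] using h
    · rw [← dist_eq_norm]
      refine (hf.lipschitz_fderiv.dist_le_mul y x).trans ?_
      gcongr
      exact hy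
  have hlin : |fderiv ℝ f x v| ≤ L * ‖v‖ :=
    (fderiv ℝ f x).le_of_opNorm_le (norm_fderiv_le_of_lipschitz ℝ hf.lipschitz) v
  set r := f (x + v) - f x - fderiv ℝ f x v with hr
  have hsum : f (x + v) - f x = fderiv ℝ f x v + r := by ring
  have h1 : fderiv ℝ f x v * r ≤ (L * ‖v‖) * (K * ‖v‖ ^ 2) :=
    (le_abs_self _).trans (by rw [abs_mul]; gcongr)
  have h2 : r ^ 2 ≤ (K * ‖v‖ ^ 2) ^ 2 := sq_le_sq' (abs_le.1 hrem).1 (abs_le.1 hrem).2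
  rw [hsum]
  linarith

lemma integral_sq_strongDual_stdGaussian (l : StrongDual ℝ E) :
    ∫ z, l z ^ 2 ∂stdGaussian E = ‖l‖ ^ 2 := by
  rw [← variance_dual_stdGaussian, variance_of_integral_eq_zero (by fun_prop)
    (integral_strongDual_stdGaussian l)]

lemma LipschitzWith.abs_sub_gaussianAverage_le (hf : LipschitzWith L f) {t : ℝ} (ht : 0 ≤ t)
    (x z : E) :
    |f (x + t • z) - _root_.gaussianAverage t f x| ≤ t * (L * (‖z‖ + ∫ w, ‖w‖ ∂stdGaussian E)) := by
  have hn : Integrable (fun w : E ↦ ‖w‖) (stdGaussian E) :=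
    (IsGaussian.integrable_id (μ := stdGaussian E)).norm
  have hint := (hf.comp_add_smul x t).integrable_stdGaussian
  have h : f (x + t • z) - _root_.gaussianAverage t f x
      = ∫ w, (f (x + t • z) - f (x + t • w)) ∂stdGaussian E := by
    rw [integral_sub (integrable_const (f (x + t • z))) hint]
    simp [_root_.gaussianAverage]
  rw [h]
  have h2 : t * (L * (‖z‖ + ∫ w, ‖w‖ ∂stdGaussian E))
      = ∫ w : E, t * (L * (‖z‖ + ‖w‖)) ∂stdGaussian E := by
    rw [integral_const_mul, integral_const_mul, integral_add (integrable_const _) hn]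
    simp
  rw [h2, ← norm_eq_abs]
  refine norm_integral_le_of_norm_le ((((integrable_const _).add hn).const_mul _).const_mul _)
    (.of_forall fun w ↦ ?_)
  have h3 := hf.dist_le_mul (x + t • z) (x + t • w)
  rw [dist_add_left, dist_eq_norm, dist_eq_norm, ← smul_sub, norm_smul, norm_of_nonneg ht] at h3
  calc _ ≤ L * (t * ‖z - w‖) := h3
    _ ≤ L * (t * (‖z‖ + ‖w‖)) := by gcongr; exact _root_.norm_sub_le z w
    _ = _ := by ring

lemma LipschitzWithFDeriv.integral_sq_sub_gaussianAverage_le (hf : LipschitzWithFDeriv L K f)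
    {t : ℝ} (ht : 0 ≤ t) (ht1 : t ≤ 1) (x : E) :
    ∫ z, (f (x + t • z) - _root_.gaussianAverage t f x) ^ 2 ∂stdGaussian E
      ≤ t ^ 2 * L ^ 2
        + t ^ 3 * ((12 * L * K + 24 * K ^ 2) * ∫ z : E, exp ‖z‖ ∂stdGaussian E) := by
  have hc := hf.lipschitz.continuous
  have hexp : Integrable (fun z : E ↦ exp ‖z‖) (stdGaussian E) := by
    simpa using integrable_exp_mul_norm_stdGaussian (E := E) 1
  have hl : Integrable (fun z ↦ fderiv ℝ f x z ^ 2) (stdGaussian E) :=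
    ((fderiv ℝ f x).comp_memLp' IsGaussian.memLp_two_id).integrable_sq
  have hnorm : ‖fderiv ℝ f x‖ ≤ L := norm_fderiv_le_of_lipschitz ℝ hf.lipschitz
  calc ∫ z, (f (x + t • z) - _root_.gaussianAverage t f x) ^ 2 ∂stdGaussian E
      = Var[fun z ↦ f (x + t • z) - f x; stdGaussian E] := by
        rw [variance_sub_const (by fun_prop), variance_eq_integral (by fun_prop)]
        rfl
    _ ≤ ∫ z, (f (x + t • z) - f x) ^ 2 ∂stdGaussian E :=
        variance_le_expectation_sq (by fun_prop)
    _ ≤ ∫ z, (t ^ 2 * fderiv ℝ f x z ^ 2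
          + t ^ 3 * ((12 * L * K + 24 * K ^ 2) * exp ‖z‖)) ∂stdGaussian E := by
        refine integral_mono_of_nonneg (.of_forall fun z ↦ sq_nonneg _)
          ((hl.const_mul _).add ((hexp.const_mul _).const_mul _)) (.of_forall fun z ↦ ?_)
        have h := hf.sq_sub_le x (t • z)
        rw [norm_smul, norm_of_nonneg ht, map_smul, smul_eq_mul] at h
        have h3 : ‖z‖ ^ 3 ≤ 6 * exp ‖z‖ := by
          simpa [Nat.factorial] using pow_le_factorial_mul_exp (norm_nonneg z) 3
        have h4 : ‖z‖ ^ 4 ≤ 24 * exp ‖z‖ := by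
          simpa [Nat.factorial] using pow_le_factorial_mul_exp (norm_nonneg z) 4
        have ht4 : t ^ 4 ≤ t ^ 3 := pow_le_pow_of_le_one ht ht1 (by norm_num)
        calc (f (x + t • z) - f x) ^ 2
            ≤ t ^ 2 * fderiv ℝ f x z ^ 2 + 2 * L * K * (t ^ 3 * ‖z‖ ^ 3)
              + K ^ 2 * (t ^ 4 * ‖z‖ ^ 4) := by linarith
          _ ≤ t ^ 2 * fderiv ℝ f x z ^ 2 + 2 * L * K * (t ^ 3 * (6 * exp ‖z‖))
              + K ^ 2 * (t ^ 3 * (24 * exp ‖z‖)) := by gcongr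
          _ = _ := by ring
    _ = t ^ 2 * ‖fderiv ℝ f x‖ ^ 2
        + t ^ 3 * ((12 * L * K + 24 * K ^ 2) * ∫ z : E, exp ‖z‖ ∂stdGaussian E) := by
        rw [integral_add (hl.const_mul _) ((hexp.const_mul _).const_mul _), integral_const_mul,
          integral_const_mul, integral_const_mul, integral_sq_strongDual_stdGaussian]
    _ ≤ _ := by gcongr

/-- The sub-Gaussian bound at small times, with an error of higher order in `t`. -/
lemma exists_gaussianAverage_exp_le (E : Type*) [NormedAddCommGroup E] [InnerProductSpace ℝ E]
    [FiniteDimensional ℝ E] [MeasurableSpace E] [BorelSpace E] (L K : ℝ≥0) :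
    ∃ C : ℝ, ∀ t : ℝ, 0 ≤ t → t ≤ 1 → ∀ f : E → ℝ, LipschitzWithFDeriv L K f → ∀ x,
      gaussianAverage t (fun y ↦ exp (f y)) x
        ≤ exp (gaussianAverage t f x + (t ^ 2 * L ^ 2 / 2 + C * t ^ 3)) := by
  set M := ∫ w : E, ‖w‖ ∂stdGaussian E
  have hM : 0 ≤ M := integral_nonneg fun _ ↦ norm_nonneg _
  set A := (12 * L * K + 24 * K ^ 2) * ∫ z : E, exp ‖z‖ ∂stdGaussian E
  set B := ∫ z : E, 6 * exp ((L + L) * (‖z‖ + M)) ∂stdGaussian E with hB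
  refine ⟨A / 2 + B, fun t ht ht1 f hf x ↦ ?_⟩
  have hBint : Integrable (fun z : E ↦ 6 * exp ((L + L) * (‖z‖ + M))) (stdGaussian E) := by
    simp_rw [mul_add _ _ M, exp_add]
    exact ((integrable_exp_mul_norm_stdGaussian _).mul_const _).const_mul _
  have hc := hf.lipschitz.continuous
  have hint := (hf.lipschitz.comp_add_smul x t).integrable_stdGaussian
  set m := gaussianAverage t f x with hm
  have hu (z : E) : |f (x + t • z) - m| ≤ t * (L * (‖z‖ + M)) :=
    hf.lipschitz.abs_sub_gaussianAverage_le ht x z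
  have hu2 : Integrable (fun z ↦ (f (x + t • z) - m) ^ 2) (stdGaussian E) := by
    refine MemLp.integrable_sq (MemLp.of_le (g := fun z : E ↦ t * (L * (‖z‖ + M)))
      ?_ (by fun_prop) (.of_forall fun z ↦ (hu z).trans (le_abs_self _)))
    exact ((IsGaussian.memLp_two_id.norm.add (memLp_const M)).const_mul _).const_mul _
  have hu0 : ∫ z, (f (x + t • z) - m) ∂stdGaussian E = 0 := by
    rw [integral_sub hint (integrable_const _)]
    simp [hm, gaussianAverage]
  have hint1 : Integrable (fun z ↦ f (x + t • z) - m) (stdGaussian E) :=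
    hint.sub (integrable_const _)
  have hint2 : Integrable (fun z ↦ 1 + (f (x + t • z) - m)) (stdGaussian E) :=
    (integrable_const _).add hint1
  have hint3 : Integrable (fun z ↦ 1 + (f (x + t • z) - m) + (f (x + t • z) - m) ^ 2 / 2)
      (stdGaussian E) := hint2.add (hu2.div_const _)
  calc gaussianAverage t (fun y ↦ exp (f y)) x
      = exp m * ∫ z, exp (f (x + t • z) - m) ∂stdGaussian E := by
        rw [← integral_const_mul]
        simp [← exp_add, gaussianAverage]
    _ ≤ exp m * ∫ z, (1 + (f (x + t • z) - m) + (f (x + t • z) - m) ^ 2 / 2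
          + t ^ 3 * (6 * exp ((L + L) * (‖z‖ + M)))) ∂stdGaussian E := by
        refine mul_le_mul_of_nonneg_left ?_ (exp_pos m).le
        refine integral_mono_of_nonneg (.of_forall fun z ↦ (exp_pos _).le)
          (hint3.add (hBint.const_mul _)) (.of_forall fun z ↦ ?_)
        refine (exp_le_one_add_add_sq_add_abs_pow_mul_exp _).trans ?_
        refine add_le_add_right ?_ _
        have h0 : 0 ≤ L * (‖z‖ + M) := by positivity
        calc |f (x + t • z) - m| ^ 3 * exp |f (x + t • z) - m|
            ≤ (t * (L * (‖z‖ + M))) ^ 3 * exp (L * (‖z‖ + M)) := by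
              gcongr
              · exact hu z
              · exact (hu z).trans (mul_le_of_le_one_left h0 ht1)
          _ = t ^ 3 * ((L * (‖z‖ + M)) ^ 3 * exp (L * (‖z‖ + M))) := by ring
          _ ≤ t ^ 3 * (6 * exp (L * (‖z‖ + M)) * exp (L * (‖z‖ + M))) := by
              gcongr
              simpa [Nat.factorial] using pow_le_factorial_mul_exp h0 3
          _ = _ := by rw [mul_assoc, ← exp_add, add_mul]
    _ = exp m * (1 + (∫ z, (f (x + t • z) - m) ^ 2 ∂stdGaussian E) / 2 + t ^ 3 * B) := by
        rw [integral_add hint3 (hBint.const_mul _), integral_add hint2 (hu2.div_const _),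
          integral_add (integrable_const _) hint1, hu0, integral_div,
          integral_const_mul (t ^ 3), ← hB]
        simp
    _ ≤ exp m * (1 + (t ^ 2 * L ^ 2 + t ^ 3 * A) / 2 + t ^ 3 * B) := by
        gcongr
        exact hf.integral_sq_sub_gaussianAverage_le ht ht1 x
    _ ≤ exp m * exp (t ^ 2 * L ^ 2 / 2 + (A / 2 + B) * t ^ 3) := by
        gcongr
        linarith [add_one_le_exp (t ^ 2 * L ^ 2 / 2 + (A / 2 + B) * t ^ 3)]
    _ = _ := by rw [← exp_add]

lemma LipschitzWithFDeriv.gaussianAverage_one_exp_le (hf : LipschitzWithFDeriv L K f) (x : E) :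
    _root_.gaussianAverage 1 (fun y ↦ exp (f y)) x
      ≤ exp (_root_.gaussianAverage 1 f x + L ^ 2 / 2) := by
  obtain ⟨C, hC⟩ := exists_gaussianAverage_exp_le E L K
  have hiter (m : ℕ) {t c : ℝ} (h : ∀ f : E → ℝ, LipschitzWithFDeriv L K f → ∀ x,
      _root_.gaussianAverage t (fun y ↦ exp (f y)) x ≤ exp (_root_.gaussianAverage t f x + c)) :
      ∀ f : E → ℝ, LipschitzWithFDeriv L K f → ∀ x,
        _root_.gaussianAverage (√2 ^ m * t) (fun y ↦ exp (f y)) x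
          ≤ exp (_root_.gaussianAverage (√2 ^ m * t) f x + 2 ^ m * c) := by
    induction m with
    | zero => simpa using h
    | succ m ih =>
      intro f hf x
      have := gaussianAverage_exp_le_of_le ih hf x
      rwa [← mul_assoc, ← mul_assoc, ← pow_succ', ← pow_succ'] at this
  have hs : (1 : ℝ) < √2 := by simp [lt_sqrt]
  have hb (m : ℕ) : _root_.gaussianAverage 1 (fun y ↦ exp (f y)) x
      ≤ exp (_root_.gaussianAverage 1 f x + (L ^ 2 / 2 + C * (√2)⁻¹ ^ m)) := by
    have ht1 : (√2)⁻¹ ^ m ≤ 1 := pow_le_one₀ (by positivity) (inv_le_one_of_one_le₀ hs.le)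
    have h := hiter m (hC ((√2)⁻¹ ^ m) (by positivity) ht1) f hf x
    have h1 : √2 ^ m * (√2)⁻¹ ^ m = 1 := by
      rw [← mul_pow, mul_inv_cancel₀ (by positivity), one_pow]
    have h2 : (2 : ℝ) ^ m = (√2 ^ m) ^ 2 := by
      rw [← pow_mul, mul_comm, pow_mul, sq_sqrt (by norm_num)]
    have h3 : (2 : ℝ) ^ m * (((√2)⁻¹ ^ m) ^ 2 * L ^ 2 / 2 + C * ((√2)⁻¹ ^ m) ^ 3)
        = (√2 ^ m * (√2)⁻¹ ^ m) ^ 2 * (L ^ 2 / 2 + C * (√2)⁻¹ ^ m) := by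
      rw [h2]
      ring
    rwa [h3, h1, one_pow, one_mul] at h
  refine ge_of_tendsto' (x := Filter.atTop) (f := fun m : ℕ ↦
    exp (_root_.gaussianAverage 1 f x + (L ^ 2 / 2 + C * (√2)⁻¹ ^ m))) ?_ hb
  have hlim := tendsto_pow_atTop_nhds_zero_of_lt_one (r := (√2)⁻¹) (by positivity)
    (inv_lt_one_of_one_lt₀ hs)
  have := (continuous_exp.tendsto _).comp
    (((hlim.const_mul C).const_add ((L : ℝ) ^ 2 / 2)).const_add (_root_.gaussianAverage 1 f x))
  simpa [Function.comp_def] using this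

lemma HasCompactSupport.lipschitzWith_convolution_left {F G : Type*} [NormedAddCommGroup F]
    [NormedSpace ℝ F] [NormedAddCommGroup G] [NormedSpace ℝ G] (B : F →L[ℝ] ℝ →L[ℝ] G)
    {φ : E → F} (hφ : HasCompactSupport φ) (hφc : Continuous φ) (hf : LipschitzWith L f) :
    LipschitzWith (‖B‖₊ * L * (∫ y, ‖φ y‖).toNNReal) (φ ⋆[B] f) := by
  have hex := hφ.convolutionExists_left (μ := volume) B hφc hf.continuous.locallyIntegrable
  have hφi : Integrable (fun y ↦ ‖φ y‖) := (hφc.integrable_of_hasCompactSupport hφ).norm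
  refine LipschitzWith.of_dist_le_mul fun x y ↦ ?_
  simp only [NNReal.coe_mul, coe_nnnorm, coe_toNNReal _ (integral_nonneg fun y ↦ norm_nonneg (φ y))]
  rw [dist_eq_norm, convolution_def, convolution_def, ← integral_sub (hex x) (hex y)]
  have : ‖B‖ * L * (∫ y, ‖φ y‖) * dist x y = ∫ z, ‖B‖ * ‖φ z‖ * (L * dist x y) := by
    rw [integral_mul_const, integral_const_mul]
    ring
  rw [this]
  refine norm_integral_le_of_norm_le ((hφi.const_mul _).mul_const _) (.of_forall fun z ↦ ?_)
  rw [← map_sub]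
  refine (B.le_opNorm₂ _ _).trans ?_
  gcongr
  simpa [dist_eq_norm] using hf.dist_le_mul (x - z) (y - z)

lemma LipschitzWith.exists_lipschitzWithFDeriv_abs_sub_le (hf : LipschitzWith L f) {ε : ℝ}
    (hε : 0 < ε) :
    ∃ K : ℝ≥0, ∃ g : E → ℝ, LipschitzWithFDeriv L K g ∧ ∀ x, |g x - f x| ≤ L * ε := by
  set φ : ContDiffBump (0 : E) := ⟨ε / 2, ε, half_pos hε, half_lt_self hε⟩
  have hsupp := φ.hasCompactSupport_normed (μ := volume)
  have hφ : ContDiff ℝ 1 (φ.normed volume) := φ.contDiff_normed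
  have hder := hsupp.hasFDerivAt_convolution_left (ContinuousLinearMap.lsmul ℝ ℝ) hφ
    (hf.continuous.locallyIntegrable (μ := volume))
  have hder' := (hsupp.fderiv ℝ).lipschitzWith_convolution_left
    (ContinuousLinearMap.precompL E (ContinuousLinearMap.lsmul ℝ ℝ))
    (hφ.continuous_fderiv one_ne_zero) hf
  rw [← funext fun x ↦ (hder x).fderiv] at hder'
  refine ⟨_, φ.normed volume ⋆[ContinuousLinearMap.lsmul ℝ ℝ] f,
    ⟨?_, fun x ↦ (hder x).differentiableAt, hder'⟩, fun x ↦ ?_⟩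
  · refine (hsupp.lipschitzWith_convolution_left _ hφ.continuous hf).weaken ?_
    simp_rw [norm_of_nonneg (φ.nonneg_normed _), φ.integral_normed]
    rw [toNNReal_one, mul_one]
    exact mul_le_of_le_one_left zero_le ContinuousLinearMap.opNorm_lsmul_le
  · rw [← dist_eq]
    refine φ.dist_normed_convolution_le hf.continuous.aestronglyMeasurable fun y hy ↦ ?_
    refine (hf.dist_le_mul y x).trans ?_
    gcongr
    exact (Metric.mem_ball.1 hy).le

lemma LipschitzWith.integral_exp_stdGaussian_le (hf : LipschitzWith L f) :
    ∫ z, exp (f z) ∂stdGaussian E ≤ exp (∫ z, f z ∂stdGaussian E + L ^ 2 / 2) := by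
  have hb (ε : ℝ) (hε : 0 < ε) : ∫ z, exp (f z) ∂stdGaussian E
      ≤ exp (∫ z, f z ∂stdGaussian E + L ^ 2 / 2 + 2 * (L * ε)) := by
    obtain ⟨K, g, hg, hgf⟩ := hf.exists_lipschitzWithFDeriv_abs_sub_le hε
    have h := hg.gaussianAverage_one_exp_le 0
    simp only [_root_.gaussianAverage, one_smul, zero_add] at h
    have hmean : ∫ z, g z ∂stdGaussian E ≤ ∫ z, f z ∂stdGaussian E + L * ε := by
      calc ∫ z, g z ∂stdGaussian E
          ≤ ∫ z, (f z + L * ε) ∂stdGaussian E :=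
            integral_mono hg.lipschitz.integrable_stdGaussian
              (hf.integrable_stdGaussian.add (integrable_const _)) fun z ↦ by
                linarith [(abs_le.1 (hgf z)).2]
        _ = _ := by
            rw [integral_add hf.integrable_stdGaussian (integrable_const _)]
            simp
    calc ∫ z, exp (f z) ∂stdGaussian E
        ≤ ∫ z, exp (g z) * exp (L * ε) ∂stdGaussian E := by
          refine integral_mono hf.integrable_exp_comp_stdGaussian
            (hg.lipschitz.integrable_exp_comp_stdGaussian.mul_const _) fun z ↦ ?_
          simp only [← exp_add]
          gcongr
          linarith [(abs_le.1 (hgf z)).1]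
      _ ≤ exp (∫ z, g z ∂stdGaussian E + L ^ 2 / 2) * exp (L * ε) := by
          rw [integral_mul_const]
          gcongr
      _ ≤ exp (∫ z, f z ∂stdGaussian E + L * ε + L ^ 2 / 2) * exp (L * ε) := by gcongr
      _ = _ := by
          rw [← exp_add]
          ring_nf
  refine ge_of_tendsto (x := nhdsWithin 0 (Set.Ioi 0)) (f := fun ε : ℝ ↦
    exp (∫ z, f z ∂stdGaussian E + L ^ 2 / 2 + 2 * (L * ε))) ?_
    (Filter.eventually_of_mem self_mem_nhdsWithin hb)
  refine Filter.Tendsto.mono_left ?_ nhdsWithin_le_nhds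
  have : Continuous fun ε : ℝ ↦ exp (∫ z, f z ∂stdGaussian E + L ^ 2 / 2 + 2 * (L * ε)) := by
    fun_prop
  simpa using this.tendsto 0

/-- A Lipschitz function of a standard Gaussian vector is sub-Gaussian after centering. -/
theorem LipschitzWith.hasSubgaussianMGF_stdGaussian (hf : LipschitzWith L f) :
    HasSubgaussianMGF (fun x ↦ f x - ∫ y, f y ∂stdGaussian E) (L ^ 2) (stdGaussian E) := by
  have hlip (s : ℝ) : LipschitzWith (‖s‖₊ * L)
      (fun x ↦ s * (f x - ∫ y, f y ∂stdGaussian E)) := by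
    refine LipschitzWith.of_dist_le_mul fun x y ↦ ?_
    have := hf.dist_le_mul x y
    simp only [dist_eq_norm, ← mul_sub, sub_sub_sub_cancel_right, norm_mul] at this ⊢
    rw [NNReal.coe_mul, coe_nnnorm, mul_assoc]
    gcongr
  refine ⟨fun s ↦ (hlip s).integrable_exp_comp_stdGaussian, fun s ↦ ?_⟩
  refine (hlip s).integral_exp_stdGaussian_le.trans_eq ?_
  rw [integral_const_mul, integral_sub hf.integrable_stdGaussian (integrable_const _)]
  simp only [integral_const, probReal_univ, one_smul, sub_self, mul_zero, zero_add,
    NNReal.coe_mul, NNReal.coe_pow, coe_nnnorm, norm_eq_abs, mul_pow, sq_abs]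
  ring_nf

end LipschitzGaussian

/-- Gaussian concentration for Lipschitz functions: if `X = (X₁,...,Xₙ)` is a vector of
i.i.d. standard Gaussians and `f : ℝⁿ → ℝ` is `L`-Lipschitz w.r.t. the Euclidean norm,
then `f(X) − E[f(X)]` is sub-Gaussian with parameter at most `L`; in particular
`P(|f(X) − E[f(X)]| ≥ t) ≤ 2 exp(−t²/(2L²))` for all `t ≥ 0`. -/
theorem gaussian_lipschitz_concentration (n : ℕ) (hn : 0 < n)
    (f : (Fin n → ℝ) → ℝ) (hfmeas : Measurable f)
    (L : ℝ) (hL : 0 ≤ L)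
    (hlip : ∀ x y : Fin n → ℝ,
      |f x - f y| ≤ L * Real.sqrt (∑ i, (x i - y i) ^ 2)) :
    (∀ lam : ℝ,
      ∫ x, exp (lam * (f x - ∫ y, f y ∂(Measure.pi fun _ : Fin n => gaussianReal 0 1)))
          ∂(Measure.pi fun _ : Fin n => gaussianReal 0 1)
        ≤ exp (lam ^ 2 * L ^ 2 / 2)) ∧
    ∀ t : ℝ, 0 ≤ t →
      (Measure.pi fun _ : Fin n => gaussianReal 0 1)
          {x | t ≤ |f x - ∫ y, f y ∂(Measure.pi fun _ : Fin n => gaussianReal 0 1)|}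
        ≤ ENNReal.ofReal (2 * exp (-(t ^ 2) / (2 * L ^ 2))) := by
  have hF : LipschitzWith L.toNNReal
      (fun x : EuclideanSpace ℝ (Fin n) ↦ f (WithLp.ofLp x)) := by
    refine LipschitzWith.of_dist_le_mul fun x y ↦ ?_
    simpa [EuclideanSpace.dist_eq, dist_eq, sq_abs, hL] using hlip x.ofLp y.ofLp
  have hsub : HasSubgaussianMGF
      (fun x ↦ f x - ∫ y, f y ∂(Measure.pi fun _ : Fin n => gaussianReal 0 1)) (L.toNNReal ^ 2)
      (Measure.pi fun _ : Fin n => gaussianReal 0 1) := by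
    have h := hF.hasSubgaussianMGF_stdGaussian
    rw [← map_pi_eq_stdGaussian] at h
    have h2 := h.of_map (Y := WithLp.toLp 2) (by fun_prop)
    rw [integral_map (by fun_prop) hF.continuous.aestronglyMeasurable] at h2
    exact h2
  have hL2 : ((L.toNNReal ^ 2 : NNReal) : ℝ) = L ^ 2 := by simp [hL]
  refine ⟨fun lam ↦ ?_, fun t ht ↦ ?_⟩
  · refine (hsub.mgf_le lam).trans_eq ?_
    rw [hL2, mul_comm]
  · have h1 := hsub.measure_ge_le ht
    have h2 := hsub.neg.measure_ge_le ht
    rw [hL2] at h1 h2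
    rw [← ofReal_measureReal]
    refine ENNReal.ofReal_le_ofReal ?_
    refine ((measureReal_mono fun x hx ↦ ?_).trans
      ((measureReal_union_le _ _).trans (add_le_add h1 h2))).trans_eq (by ring)
    rw [Set.mem_ofPred_eq] at hx
    exact le_abs.1 hx
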